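/- Let N ≥ 2, let k ∈ ℝ, let n : EuclideanSpace ℝ (Fin N) → ℝ, let R ∈ ℝ and let a, b ∈ EuclideanSpace ℝ (Fin N). Let V ⊆ EuclideanSpace ℝ (Fin N) be open and let Ψ be twice continuously differentiable on V with Δ Ψ(y) + k² · n(y)² · Ψ(y) = 0 for all y ∈ V. Define the map I(r) = (R²/‖r − a‖²)·(r − a) + b and Φ(r) = ‖r − a‖^{−(N−2)} · Ψ(I(r)). Then for every r ≠ a with I(r) ∈ V one has Δ Φ(r) + (k² R⁴/‖r − a‖⁴) · n(I(r))² · Φ(r) = 0. -/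

import Mathlib

/-- The Laplacian of a real-valued function on `EuclideanSpace ℝ (Fin N)`:
the sum of the second partial derivatives, i.e. the trace of the second
Fréchet derivative. -/
noncomputable def laplacian {N : ℕ} (f : EuclideanSpace ℝ (Fin N) → ℝ)
    (x : EuclideanSpace ℝ (Fin N)) : ℝ :=
  ∑ i : Fin N,
    iteratedFDeriv ℝ 2 f x ![EuclideanSpace.single i 1, EuclideanSpace.single i 1]

open Filter Topology

lemma second_dir {E : Type*} [NormedAddCommGroup E] [NormedSpace ℝ E] (f : E → ℝ) (x e : E)
    (hf : ContDiffAt ℝ 2 f x) (g' : ℝ → ℝ) (g'' : ℝ)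
    (h1 : ∀ᶠ t in 𝓝 (0 : ℝ), HasDerivAt (fun t : ℝ => f (x + t • e)) (g' t) t)
    (h2 : HasDerivAt g' g'' 0) : iteratedFDeriv ℝ 2 f x ![e, e] = g'' := by
  rw [iteratedFDeriv_two_apply]
  have hline : ∀ t : ℝ, HasDerivAt (fun t : ℝ => x + t • e) e t := fun t => by
    simpa using ((hasDerivAt_id t).smul_const e).const_add x
  have hx0 : x + (0 : ℝ) • e = x := by simp
  have hd : HasFDerivAt (fderiv ℝ f) (fderiv ℝ (fderiv ℝ f) x) (x + (0 : ℝ) • e) := by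
    rw [hx0]
    exact ((hf.fderiv_right (m := 1) (by norm_num)).differentiableAt (by norm_num)).hasFDerivAt
  have h3 : HasDerivAt (fun t : ℝ => fderiv ℝ f (x + t • e) e) (fderiv ℝ (fderiv ℝ f) x e e) 0 := by
    have hB : HasDerivAt (fun t : ℝ => fderiv ℝ f (x + t • e)) (fderiv ℝ (fderiv ℝ f) x e) 0 :=
      hd.comp_hasDerivAt (0 : ℝ) (hline 0)
    have := hB.clm_apply (hasDerivAt_const (0 : ℝ) e)
    simpa using this
  have hev : ∀ᶠ t in 𝓝 (0 : ℝ), ContDiffAt ℝ 2 f (x + t • e) := by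
    have hc : Tendsto (fun t : ℝ => x + t • e) (𝓝 0) (𝓝 x) := by
      have := (hline 0).continuousAt.tendsto
      simpa using this
    exact hc.eventually (hf.eventually (by simp))
  have h4 : g' =ᶠ[𝓝 0] (fun t : ℝ => fderiv ℝ f (x + t • e) e) := by
    filter_upwards [h1, hev] with t ht hct
    have hq := (hct.differentiableAt (by norm_num)).hasFDerivAt.comp_hasDerivAt t (hline t)
    exact ht.unique hq
  simpa using (h3.congr_of_eventuallyEq h4).unique h2

variable {N : ℕ}

noncomputable def dirVal (s C : ℝ) (b : EuclideanSpace ℝ (Fin N))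
    (Ψ : EuclideanSpace ℝ (Fin N) → ℝ) (x e : EuclideanSpace ℝ (Fin N)) : ℝ :=
      let ρ : ℝ := inner ℝ x x
      let ξ : ℝ := inner ℝ x e
      let y := (C * ρ⁻¹) • x + b
      let L := fderiv ℝ Ψ y
      let B := fderiv ℝ (fderiv ℝ Ψ) y
      ρ ^ (-s) * ((-2 * s * ρ⁻¹ + 4 * s * (s + 1) * ρ⁻¹ ^ 2 * ξ ^ 2) * Ψ y
       + 2 * (-2 * s * ρ⁻¹ * ξ) * (C * (ρ⁻¹ * L e - 2 * ρ⁻¹ ^ 2 * ξ * L x))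
       + C * (-4 * ρ⁻¹ ^ 2 * ξ * L e - 2 * ρ⁻¹ ^ 2 * L x + 8 * ρ⁻¹ ^ 3 * ξ ^ 2 * L x)
       + C ^ 2 * (ρ⁻¹ ^ 2 * B e e - 2 * ρ⁻¹ ^ 3 * ξ * (B e x + B x e)
          + 4 * ρ⁻¹ ^ 4 * ξ ^ 2 * B x x))

lemma term_calc (s C : ℝ) (b : EuclideanSpace ℝ (Fin N))
    (Ψ : EuclideanSpace ℝ (Fin N) → ℝ)
    (x e : EuclideanSpace ℝ (Fin N)) (hx : x ≠ 0) (he : inner ℝ e e = 1)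
    (hΨ : ContDiffAt ℝ 2 Ψ ((C * (inner ℝ x x)⁻¹) • x + b)) :
    ∃ g' : ℝ → ℝ, (∀ᶠ t in 𝓝 (0 : ℝ), HasDerivAt (fun t : ℝ =>
      (inner ℝ (x + t • e) (x + t • e)) ^ (-s) *
       Ψ ((C * (inner ℝ (x + t • e) (x + t • e))⁻¹) • (x + t • e) + b)) (g' t) t) ∧
    HasDerivAt g' (dirVal s C b Ψ x e) 0 := by
  set p : ℝ → EuclideanSpace ℝ (Fin N) := fun t => x + t • e with hp
  set q : ℝ → ℝ := fun t => inner ℝ (p t) (p t) with hq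
  set J : ℝ → EuclideanSpace ℝ (Fin N) := fun t => (C * (q t)⁻¹) • p t + b with hJ
  have hp' : ∀ t, HasDerivAt p e t := fun t => by
    simpa [hp] using ((hasDerivAt_id t).smul_const e).const_add x
  have hxp : ∀ t, HasDerivAt (fun t => inner ℝ (p t) e) 1 t := fun t => by
    have h := (hp' t).inner ℝ (hasDerivAt_const t e)
    rw [he, inner_zero_right, zero_add] at h
    exact h
  have hq' : ∀ t, HasDerivAt q (2 * inner ℝ (p t) e) t := fun t => by
    have := (hp' t).inner ℝ (hp' t)
    refine this.congr_deriv ?_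
    rw [real_inner_comm e (p t)]; ring
  have hp0 : p 0 = x := by simp [hp]
  have hq0 : q 0 = inner ℝ x x := by simp [hq, hp0]
  have hρ : 0 < (inner ℝ x x : ℝ) := by
    rw [real_inner_self_eq_norm_sq]; have := norm_pos_iff.2 hx; positivity
  have hqpos : ∀ᶠ t in 𝓝 (0 : ℝ), 0 < q t :=
    (hq' 0).continuousAt.eventually (lt_mem_nhds (by rw [hq0]; exact hρ))
  have hqi : ∀ t, 0 < q t → HasDerivAt (fun t => (q t)⁻¹) (-2 * inner ℝ (p t) e * (q t)⁻¹ ^ 2) t := by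
    intro t ht
    refine ((hq' t).inv ht.ne').congr_deriv ?_
    field_simp
  have hqs : ∀ t, 0 < q t → HasDerivAt (fun t => (q t) ^ (-s))
      (q t ^ (-s) * (-2 * s * (q t)⁻¹ * inner ℝ (p t) e)) t := by
    intro t ht
    refine ((hq' t).rpow_const (p := -s) (Or.inl ht.ne')).congr_deriv ?_
    rw [Real.rpow_sub_one ht.ne']
    field_simp
  set J' : ℝ → EuclideanSpace ℝ (Fin N) := fun t =>
    (C * (q t)⁻¹) • e + (C * (-2 * inner ℝ (p t) e * (q t)⁻¹ ^ 2)) • p t with hJ'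
  have hJd : ∀ t, 0 < q t → HasDerivAt J (J' t) t := by
    intro t ht
    exact (((hqi t ht).const_mul C).smul (hp' t)).add_const b
  have hJ0 : J 0 = (C * (inner ℝ x x)⁻¹) • x + b := by simp [hJ, hq0, hp0]
  have hΨ0 : ContDiffAt ℝ 2 Ψ (J 0) := by rw [hJ0]; exact hΨ
  have h0 : 0 < q 0 := by rw [hq0]; exact hρ
  have hev : ∀ᶠ t in 𝓝 (0 : ℝ), ContDiffAt ℝ 2 Ψ (J t) :=
    (hJd 0 h0).continuousAt.eventually (hΨ0.eventually (by simp))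
  have hΨd : ∀ t, 0 < q t → ContDiffAt ℝ 2 Ψ (J t) →
      HasDerivAt (fun t => Ψ (J t)) (fderiv ℝ Ψ (J t) (J' t)) t := fun t ht hc =>
    (hc.differentiableAt (by norm_num)).hasFDerivAt.comp_hasDerivAt t (hJd t ht)
  refine ⟨fun t => (q t ^ (-s) * (-2 * s * (q t)⁻¹ * inner ℝ (p t) e)) * Ψ (J t)
    + q t ^ (-s) * fderiv ℝ Ψ (J t) (J' t), ?_, ?_⟩
  · filter_upwards [hqpos, hev] with t ht hc
    exact (hqs t ht).mul (hΨd t ht hc)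
  · have hB : HasDerivAt (fun t => fderiv ℝ Ψ (J t)) (fderiv ℝ (fderiv ℝ Ψ) (J 0) (J' 0)) 0 :=
      ((hΨ0.fderiv_right (m := 1) (by norm_num)).differentiableAt
        (by norm_num)).hasFDerivAt.comp_hasDerivAt (0 : ℝ) (hJd 0 h0)
    have hJ'd : HasDerivAt J' _ 0 := (((hqi 0 h0).const_mul C).smul_const e).add
      (((((hxp 0).const_mul (-2)).mul ((hqi 0 h0).pow 2)).const_mul C).smul (hp' 0))
    have hA := (hqs 0 h0).mul (((hqi 0 h0).const_mul (-2 * s)).mul (hxp 0))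
    have key := (hA.mul (hΨd 0 h0 hΨ0)).add ((hqs 0 h0).mul (hB.clm_apply hJ'd))
    refine key.congr_deriv ?_
    unfold dirVal
    simp only [hJ', hJ0, hq0, hp0, Pi.mul_apply, Pi.add_apply, Pi.pow_apply, Pi.smul_apply', map_add, map_smul,
      _root_.add_apply, _root_.smul_apply, smul_eq_mul]
    simp only [Nat.cast_ofNat, Nat.add_one_sub_one, pow_one]
    ring

theorem wavized_equation_inversion_transform
    {N : ℕ} (hN : 2 ≤ N) (k R : ℝ)
    (n : EuclideanSpace ℝ (Fin N) → ℝ)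
    (a b : EuclideanSpace ℝ (Fin N))
    (V : Set (EuclideanSpace ℝ (Fin N))) (hV : IsOpen V)
    (Ψ : EuclideanSpace ℝ (Fin N) → ℝ) (hΨ : ContDiffOn ℝ 2 Ψ V)
    (hwave : ∀ y ∈ V, laplacian Ψ y + k ^ 2 * (n y) ^ 2 * Ψ y = 0)
    (I : EuclideanSpace ℝ (Fin N) → EuclideanSpace ℝ (Fin N))
    (hI : I = fun r => (R ^ 2 / ‖r - a‖ ^ 2) • (r - a) + b)
    (Φ : EuclideanSpace ℝ (Fin N) → ℝ)
    (hΦ : Φ = fun r => ‖r - a‖ ^ (-((N : ℝ) - 2)) * Ψ (I r)) :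
    ∀ r : EuclideanSpace ℝ (Fin N), r ≠ a → I r ∈ V →
      laplacian Φ r + (k ^ 2 * R ^ 4 / ‖r - a‖ ^ 4) * (n (I r)) ^ 2 * Φ r = 0 := by
  intro r hr hIr
  have hx : r - a ≠ 0 := sub_ne_zero.2 hr
  have hnx : ‖r - a‖ ≠ 0 := norm_ne_zero_iff.2 hx
  have hΨc : ContDiffAt ℝ 2 Ψ (I r) := hΨ.contDiffAt (hV.mem_nhds hIr)
  have hsub : ContDiffAt ℝ 2 (fun r : EuclideanSpace ℝ (Fin N) => r - a) r :=
    contDiffAt_id.sub contDiffAt_const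
  have hIc : ContDiffAt ℝ 2 I r := by
    rw [hI]
    exact ((contDiffAt_const.div ((hsub.norm ℝ hx).pow 2) (pow_ne_zero 2 hnx)).smul hsub).add
      contDiffAt_const
  have hΦc : ContDiffAt ℝ 2 Φ r := by
    rw [hΦ]
    exact ((hsub.norm ℝ hx).rpow_const_of_ne hnx).mul (hΨc.comp r hIc)
  have hform : ∀ z, I z = (R ^ 2 * (inner ℝ (z - a) (z - a))⁻¹) • (z - a) + b := by
    intro z; rw [hI, real_inner_self_eq_norm_sq]; rfl
  have hΦform : ∀ z, Φ z = (inner ℝ (z - a) (z - a)) ^ (-(((N : ℝ) - 2) / 2)) * Ψ (I z) := by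
    intro z
    rw [hΦ, real_inner_self_eq_norm_sq, ← Real.rpow_natCast, ← Real.rpow_mul (norm_nonneg _)]
    congr 2
    push_cast; ring
  have hw := hwave _ hIr
  rw [hform r] at hΨc
  have hterm : ∀ i : Fin N, iteratedFDeriv ℝ 2 Φ r ![EuclideanSpace.single i 1, EuclideanSpace.single i 1]
      = dirVal (((N : ℝ) - 2) / 2) (R ^ 2) b Ψ (r - a) (EuclideanSpace.single i 1) := fun i => by
    obtain ⟨g', h1, h2⟩ := term_calc (((N : ℝ) - 2) / 2) (R ^ 2) b Ψ (r - a)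
      (EuclideanSpace.single i 1) hx (by simp) hΨc
    refine second_dir Φ r (EuclideanSpace.single i 1) hΦc g' _ ?_ h2
    convert h1 using 4 with _ t
    have : r + t • (EuclideanSpace.single i 1 : EuclideanSpace ℝ (Fin N)) - a
      = r - a + t • EuclideanSpace.single i 1 := by abel
    rw [hΦform, hform, this]
  unfold laplacian
  rw [Finset.sum_congr rfl (fun i _ => hterm i)]
  unfold dirVal
  unfold laplacian at hw
  simp only [iteratedFDeriv_two_apply, Matrix.cons_val_zero, Matrix.cons_val_one] at hw
  rw [hΦform r]
  have hn4 : ‖r - a‖ ^ 4 = (inner ℝ (r - a) (r - a)) ^ 2 := by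
    rw [real_inner_self_eq_norm_sq]; ring
  rw [hn4]
  rw [hform r] at hw ⊢
  have hρ0 : (inner ℝ (r - a) (r - a) : ℝ) ≠ 0 := by
    rw [real_inner_self_eq_norm_sq]; exact pow_ne_zero 2 hnx
  set x := r - a with hxdef
  set ρ : ℝ := inner ℝ x x with hρ
  set y := (R ^ 2 * ρ⁻¹) • x + b with hy
  set L := fderiv ℝ Ψ y
  set B := fderiv ℝ (fderiv ℝ Ψ) y
  have hin : ∀ i : Fin N, inner ℝ x (EuclideanSpace.single i (1 : ℝ)) = x i := fun i => by
    simp [EuclideanSpace.inner_single_right]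
  have hsumx : ∑ i : Fin N, x i • (EuclideanSpace.single i (1 : ℝ)) = x := by
    have := (EuclideanSpace.basisFun (Fin N) ℝ).sum_repr x
    simpa using this
  have hS2 : ∑ i : Fin N, x i ^ 2 = ρ := by
    rw [hρ, real_inner_self_eq_norm_sq, EuclideanSpace.norm_sq_eq]; simp
  have hSL : ∑ i : Fin N, x i * L (EuclideanSpace.single i 1) = L x := by
    conv_rhs => rw [← hsumx]
    simp [map_sum]
  have hSB1 : ∑ i : Fin N, x i * B (EuclideanSpace.single i 1) x = B x x := by
    have : B x = ∑ i : Fin N, x i • B (EuclideanSpace.single i 1) := by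
      conv_lhs => rw [← hsumx]
      simp only [map_sum, map_smul]
    rw [this]; simp [ContinuousLinearMap.sum_apply]
  have hSB2 : ∑ i : Fin N, x i * B x (EuclideanSpace.single i 1) = B x x := by
    have : ∀ v, B x v = B x v := fun _ => rfl
    conv_rhs => arg 2; rw [← hsumx]
    simp only [map_sum, map_smul, smul_eq_mul]
  simp only [hin]
  have hSBB : ∑ i : Fin N, B (EuclideanSpace.single i 1) (EuclideanSpace.single i 1)
    = - (k ^ 2 * (n y) ^ 2 * Ψ y) := by linarith
  set s : ℝ := ((N : ℝ) - 2) / 2 with hs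
  have hNs : (N : ℝ) = 2 * s + 2 := by rw [hs]; ring
  rw [← Finset.mul_sum]
  set W : ℝ := ρ ^ (-s)
  have split : ∀ i : Fin N, ((-2 * s * ρ⁻¹ + 4 * s * (s + 1) * ρ⁻¹ ^ 2 * x i ^ 2) * Ψ y
       + 2 * (-2 * s * ρ⁻¹ * x i) * (R ^ 2 * (ρ⁻¹ * L (EuclideanSpace.single i 1) - 2 * ρ⁻¹ ^ 2 * x i * L x))
       + R ^ 2 * (-4 * ρ⁻¹ ^ 2 * x i * L (EuclideanSpace.single i 1) - 2 * ρ⁻¹ ^ 2 * L x + 8 * ρ⁻¹ ^ 3 * x i ^ 2 * L x)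
       + (R ^ 2) ^ 2 * (ρ⁻¹ ^ 2 * B (EuclideanSpace.single i 1) (EuclideanSpace.single i 1) - 2 * ρ⁻¹ ^ 3 * x i * (B (EuclideanSpace.single i 1) x + B x (EuclideanSpace.single i 1))
          + 4 * ρ⁻¹ ^ 4 * x i ^ 2 * B x x))
      = (-2 * s * ρ⁻¹ * Ψ y - 2 * R ^ 2 * ρ⁻¹ ^ 2 * L x)
        + (4 * s * (s + 1) * ρ⁻¹ ^ 2 * Ψ y + 8 * s * R ^ 2 * ρ⁻¹ ^ 3 * L x
            + 8 * R ^ 2 * ρ⁻¹ ^ 3 * L x + 4 * R ^ 4 * ρ⁻¹ ^ 4 * B x x) * x i ^ 2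
        + (-4 * s * R ^ 2 * ρ⁻¹ ^ 2 - 4 * R ^ 2 * ρ⁻¹ ^ 2) * (x i * L (EuclideanSpace.single i 1))
        + R ^ 4 * ρ⁻¹ ^ 2 * B (EuclideanSpace.single i 1) (EuclideanSpace.single i 1)
        + (-2 * R ^ 4 * ρ⁻¹ ^ 3) * (x i * B (EuclideanSpace.single i 1) x)
        + (-2 * R ^ 4 * ρ⁻¹ ^ 3) * (x i * B x (EuclideanSpace.single i 1)) := fun i => by ring
  rw [Finset.sum_congr rfl (fun i _ => split i)]
  simp only [Finset.sum_add_distrib, ← Finset.mul_sum, hS2, hSL, hSB1, hSB2, hSBB,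
    Finset.sum_const, Finset.card_univ, Fintype.card_fin, nsmul_eq_mul, hNs]
  field_simp
  ring
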